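/- Let x₁, x₂, x₃ be pairwise linearly independent future-pointing null vectors in ℝ³, with indices taken modulo 3, and define vᵢ := −(xᵢ⊠xᵢ₊₁)/(xᵢ·xᵢ₊₁); each vᵢ is unit spacelike. Assume v₁, v₂, v₃ are pairwise consistently oriented. For i = 1,2,3 choose aᵢ, bᵢ > 0 and set pᵢ := aᵢxᵢ − bᵢxᵢ₊₁. Then the crooked planes C(v₁,p₁), C(v₂,p₂), C(v₃,p₃) are pairwise disjoint. -/

import Mathlib

open Matrix

noncomputable section

/-- Minkowski space: ℝ³. -/
abbrev V3 : Type := Fin 3 → ℝ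

/-- The Lorentzian inner product `x·y = x₁y₁ + x₂y₂ − x₃y₃`. -/
def mdot (x y : V3) : ℝ := x 0 * y 0 + x 1 * y 1 - x 2 * y 2

/-- The Lorentzian cross product: the unique bilinear map with
`mdot u (lcross v w) = det [u v w]` (columns `u`, `v`, `w`). -/
def lcross (v w : V3) : V3 :=
  ![v 1 * w 2 - v 2 * w 1, v 2 * w 0 - v 0 * w 2, -(v 0 * w 1 - v 1 * w 0)]

/-- For a spacelike vector `v`, the future-pointing null vector `v⁺` of Euclidean
length 1 which is Lorentz-orthogonal to `v`, where `v⁻, v⁺` are ordered so that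
`det[v⁻ v⁺ v] > 0`. -/
def nullPlus (v : V3) : V3 :=
  (1 / (Real.sqrt 2 * (v 0 ^ 2 + v 1 ^ 2))) •
    ![v 0 * v 2 + v 1 * Real.sqrt (mdot v v),
      v 1 * v 2 - v 0 * Real.sqrt (mdot v v),
      v 0 ^ 2 + v 1 ^ 2]

/-- For a spacelike vector `v`, the future-pointing null vector `v⁻` of Euclidean
length 1 which is Lorentz-orthogonal to `v`, where `v⁻, v⁺` are ordered so that
`det[v⁻ v⁺ v] > 0`. -/
def nullMinus (v : V3) : V3 :=
  (1 / (Real.sqrt 2 * (v 0 ^ 2 + v 1 ^ 2))) •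
    ![v 0 * v 2 - v 1 * Real.sqrt (mdot v v),
      v 1 * v 2 + v 0 * Real.sqrt (mdot v v),
      v 0 ^ 2 + v 1 ^ 2]

/-- `P(x)`: for a future-pointing null vector `x`, the set of spacelike vectors `w`
with `w·x = 0` such that `(w/√(w·w))⁺` is a positive scalar multiple of `x`. -/
def wingSet (x : V3) : Set V3 :=
  {w | 0 < mdot w w ∧ mdot w x = 0 ∧
    ∃ t : ℝ, 0 < t ∧ nullPlus ((Real.sqrt (mdot w w))⁻¹ • w) = t • x}

/-- The crooked plane `C(v,p)`: union of the stem `p + {x | x·v = 0, x·x ≤ 0}`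
and the wings `p + P(v⁺)` and `p + P(v⁻)`. -/
def crookedPlane (v p : V3) : Set V3 :=
  {q | mdot (q - p) v = 0 ∧ mdot (q - p) (q - p) ≤ 0} ∪
  {q | q - p ∈ wingSet (nullPlus v)} ∪
  {q | q - p ∈ wingSet (nullMinus v)}

/-- The crooked half-space `H(v,p)`. -/
def crookedHalf (v p : V3) : Set V3 :=
  {q | (0 ≤ mdot (q - p) v → mdot (q - p) (nullPlus v) ≤ 0) ∧
       (mdot (q - p) v ≤ 0 → 0 ≤ mdot (q - p) (nullMinus v))}

/-- Spacelike vectors `u`, `v` are consistently oriented. -/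
def consistentlyOriented (u v : V3) : Prop :=
  mdot u v < 0 ∧ mdot u (nullPlus v) ≤ 0 ∧ mdot u (nullMinus v) ≤ 0 ∧
  mdot v (nullPlus u) ≤ 0 ∧ mdot v (nullMinus u) ≤ 0

/-- `g` is a linear isometry of the Lorentzian inner product. -/
def isLorentz (g : Matrix (Fin 3) (Fin 3) ℝ) : Prop :=
  ∀ x y : V3, mdot (g.mulVec x) (g.mulVec y) = mdot x y

/-- Membership in `SO(2,1)⁰`, the identity component of the group of linear
isometries of `mdot`: Lorentzian, determinant one, and orthochronous. -/
def inSO21p (g : Matrix (Fin 3) (Fin 3) ℝ) : Prop :=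
  isLorentz g ∧ g.det = 1 ∧ 0 < g.mulVec ![0, 0, 1] 2

/-- `g` is hyperbolic: it has three distinct real eigenvalues. -/
def isHyperbolic (g : Matrix (Fin 3) (Fin 3) ℝ) : Prop :=
  ∃ a b c : ℝ, a ≠ b ∧ a ≠ c ∧ b ≠ c ∧
    g.charpoly = (Polynomial.X - Polynomial.C a) * (Polynomial.X - Polynomial.C b) *
      (Polynomial.X - Polynomial.C c)

/-- `g ≠ I` is parabolic: `1` is its only eigenvalue. -/
def isParabolic (g : Matrix (Fin 3) (Fin 3) ℝ) : Prop :=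
  g ≠ 1 ∧ g.charpoly = (Polynomial.X - Polynomial.C 1) ^ 3

/-- `v` is a positive fixed vector of `g`: `gv = v`, `v ≠ 0`, and
`det[v x gx] > 0` for some null or timelike `x` which is not an eigenvector. -/
def positiveFixed (g : Matrix (Fin 3) (Fin 3) ℝ) (v : V3) : Prop :=
  v ≠ 0 ∧ g.mulVec v = v ∧
  ∃ x : V3, mdot x x ≤ 0 ∧ (∀ t : ℝ, g.mulVec x ≠ t • x) ∧
    0 < mdot v (lcross x (g.mulVec x))

/-- A subgroup of homeomorphisms (here: permutations) of ℝ³ acts properly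
discontinuously: for every compact `K`, only finitely many elements move `K`
to meet `K`. -/
def properlyDisc (Γ : Subgroup (Equiv.Perm V3)) : Prop :=
  ∀ K : Set V3, IsCompact K →
    {f : Equiv.Perm V3 | f ∈ Γ ∧ ((f : V3 → V3) '' K ∩ K).Nonempty}.Finite

/-- The action of `Γ` on ℝ³ is free: no nonidentity element has a fixed point. -/
def freeAction (Γ : Subgroup (Equiv.Perm V3)) : Prop :=
  ∀ f ∈ Γ, f ≠ 1 → ∀ x : V3, f x ≠ x

/-- `−(x⊠y)/(x·y)`, the unit spacelike vector corresponding to the geodesic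
joining the ideal points of future-pointing null vectors `x`, `y`. -/
def triV (x y : V3) : V3 := (-(mdot x y)⁻¹) • lcross x y

theorem mdot_comm (u v : V3) : mdot u v = mdot v u := by
  simp only [mdot]; ring

theorem mdot_smul_left (c : ℝ) (u v : V3) : mdot (c • u) v = c * mdot u v := by
  simp only [mdot, Pi.smul_apply, smul_eq_mul]; ring

theorem mdot_smul_right (c : ℝ) (u v : V3) : mdot u (c • v) = c * mdot u v := by
  simp only [mdot, Pi.smul_apply, smul_eq_mul]; ring

theorem mdot_add_left (u v w : V3) : mdot (u + v) w = mdot u w + mdot v w := by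
  simp only [mdot, Pi.add_apply]; ring

theorem mdot_sub_left (u v w : V3) : mdot (u - v) w = mdot u w - mdot v w := by
  simp only [mdot, Pi.sub_apply]; ring

theorem lcross_smul_left (c : ℝ) (u v : V3) : lcross (c • u) v = c • lcross u v := by
  ext i; fin_cases i <;> simp [lcross] <;> ring

theorem lcross_smul_right (c : ℝ) (u v : V3) : lcross u (c • v) = c • lcross u v := by
  ext i; fin_cases i <;> simp [lcross] <;> ring

theorem lcross_sub_left (u v w : V3) : lcross (u - v) w = lcross u w - lcross v w := by
  ext i; fin_cases i <;> simp [lcross] <;> ring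

theorem mdot_lcross_rotate (u v w : V3) : mdot u (lcross v w) = mdot v (lcross w u) := by
  simp [mdot, lcross]; ring

theorem mdot_lcross_self_left (u v : V3) : mdot u (lcross u v) = 0 := by
  simp [mdot, lcross]; ring

theorem mdot_lcross_self_right (u v : V3) : mdot v (lcross u v) = 0 := by
  simp [mdot, lcross]; ring

theorem mdot_lcross_lcross (u v w z : V3) :
    mdot (lcross u v) (lcross w z) = mdot u z * mdot v w - mdot u w * mdot v z := by
  simp [mdot, lcross]; ring

theorem lcross_lcross_left (u v w : V3) :
    lcross (lcross u v) w = mdot v w • u - mdot u w • v := by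
  ext i; fin_cases i <;> simp [mdot, lcross] <;> ring

/-- A vector whose cross product with a future-pointing vector vanishes is a multiple of it. -/
theorem exists_smul_of_lcross_eq_zero {u v : V3} (hv : 0 < v 2) (h : lcross u v = 0) :
    ∃ t : ℝ, u = t • v := by
  have h0 := congrFun h 0
  have h1 := congrFun h 1
  simp only [lcross, Matrix.cons_val_zero, Matrix.cons_val_one, Pi.zero_apply] at h0 h1
  refine ⟨u 2 / v 2, ?_⟩
  ext i; fin_cases i <;> simp <;> field_simp <;> linarith

/-- Independent future-pointing null vectors have negative product. -/
theorem mdot_neg_of_null {x y : V3} (hx : mdot x x = 0) (hy : mdot y y = 0)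
    (hfx : 0 < x 2) (hfy : 0 < y 2) (hli : LinearIndependent ℝ ![x, y]) : mdot x y < 0 := by
  by_contra! h
  have key : (x 0 * y 2 - y 0 * x 2) ^ 2 + (x 1 * y 2 - y 1 * x 2) ^ 2
      = -2 * (x 2 * y 2) * mdot x y := by
    simp only [mdot] at hx hy ⊢
    linear_combination y 2 ^ 2 * hx + x 2 ^ 2 * hy
  have hp : 0 ≤ x 2 * y 2 * mdot x y := by positivity
  have e0 : x 0 * y 2 - y 0 * x 2 = 0 := by
    nlinarith [sq_nonneg (x 0 * y 2 - y 0 * x 2), sq_nonneg (x 1 * y 2 - y 1 * x 2)]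
  have e1 : x 1 * y 2 - y 1 * x 2 = 0 := by
    nlinarith [sq_nonneg (x 0 * y 2 - y 0 * x 2), sq_nonneg (x 1 * y 2 - y 1 * x 2)]
  have hpair := LinearIndependent.pair_iff.1 hli (y 2) (-(x 2)) (by
    ext i; fin_cases i <;> simp <;> linarith)
  exact hfy.ne' hpair.1

theorem triV_eq (x y : V3) : triV x y = (-(mdot x y)⁻¹) • lcross x y := rfl

section Unit

variable {v : V3}

theorem sq_add_sq_pos_of_unit (hv : mdot v v = 1) : 0 < v 0 ^ 2 + v 1 ^ 2 := by
  simp only [mdot] at hv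
  nlinarith [sq_nonneg (v 2)]

/-- Cross product with a unit spacelike vector `v` fixes `v⁺`. -/
theorem lcross_nullPlus (hv : mdot v v = 1) : lcross v (nullPlus v) = nullPlus v := by
  rw [nullPlus, lcross_smul_right, hv, Real.sqrt_one]
  congr 1
  simp only [mdot] at hv
  ext i; fin_cases i <;> simp [lcross]
  · linear_combination v 1 * hv
  · linear_combination -v 0 * hv
  · ring

/-- The future-pointing vectors fixed by cross product with `v` are the multiples of `v⁺`. -/
theorem exists_nullPlus_eq {y : V3} (hv : mdot v v = 1) (hy : 0 < y 2) (h : lcross v y = y) :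
    ∃ k : ℝ, 0 < k ∧ nullPlus v = k • y := by
  have hpos := sq_add_sq_pos_of_unit hv
  have h0 := congrFun h 0
  have h1 := congrFun h 1
  simp only [lcross, Matrix.cons_val_zero, Matrix.cons_val_one] at h0 h1
  refine ⟨1 / (Real.sqrt 2 * (v 0 ^ 2 + v 1 ^ 2)) * ((v 0 ^ 2 + v 1 ^ 2) / y 2), by positivity, ?_⟩
  rw [nullPlus, mul_smul, hv, Real.sqrt_one]
  congr 1
  simp only [mdot] at hv
  ext i; fin_cases i <;> simp <;> field_simp
  · linear_combination -v 2 * h1 + h0 - y 0 * hv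
  · linear_combination h1 + v 2 * h0 - y 1 * hv

/-- The future-pointing vectors negated by cross product with `v` are the multiples of `v⁻`. -/
theorem exists_nullMinus_eq {x : V3} (hv : mdot v v = 1) (hx : 0 < x 2) (h : lcross v x = -x) :
    ∃ k : ℝ, 0 < k ∧ nullMinus v = k • x := by
  have hpos := sq_add_sq_pos_of_unit hv
  have h0 := congrFun h 0
  have h1 := congrFun h 1
  simp only [lcross, Matrix.cons_val_zero, Matrix.cons_val_one, Pi.neg_apply] at h0 h1
  refine ⟨1 / (Real.sqrt 2 * (v 0 ^ 2 + v 1 ^ 2)) * ((v 0 ^ 2 + v 1 ^ 2) / x 2), by positivity, ?_⟩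
  rw [nullMinus, mul_smul, hv, Real.sqrt_one]
  congr 1
  simp only [mdot] at hv
  ext i; fin_cases i <;> simp <;> field_simp
  · linear_combination -v 2 * h1 - h0 - x 0 * hv
  · linear_combination -h1 + v 2 * h0 - x 1 * hv

end Unit

/-- Cross product with a vector in the wing direction `P(k y)` scales `y` by a positive factor. -/
theorem exists_lcross_eq_of_mem_wingSet {y w : V3} {k : ℝ} (hk : 0 < k)
    (hw : w ∈ wingSet (k • y)) : ∃ s : ℝ, 0 < s ∧ lcross w y = s • y := by
  obtain ⟨hpos, -, t, ht, h⟩ := hw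
  have hs : 0 < Real.sqrt (mdot w w) := Real.sqrt_pos.2 hpos
  refine ⟨Real.sqrt (mdot w w), hs, ?_⟩
  have hunit : mdot ((Real.sqrt (mdot w w))⁻¹ • w) ((Real.sqrt (mdot w w))⁻¹ • w) = 1 := by
    rw [mdot_smul_left, mdot_smul_right]
    field_simp
    exact (Real.sq_sqrt hpos.le).symm
  have hfix := lcross_nullPlus hunit
  rw [h, smul_smul, lcross_smul_right, lcross_smul_left, smul_comm] at hfix
  have htk : t * k ≠ 0 := (mul_pos ht hk).ne'
  rw [smul_comm] at hfix
  have := smul_right_injective V3 htk hfix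
  rw [inv_smul_eq_iff₀ hs.ne'] at this
  exact this

section Edge

variable {x y : V3}

theorem mdot_triV_self (hx : mdot x x = 0) (hxy : mdot x y < 0) :
    mdot (triV x y) (triV x y) = 1 := by
  have h := hxy.ne
  rw [triV_eq, mdot_smul_left, mdot_smul_right, mdot_lcross_lcross, hx, mdot_comm y x]
  field_simp
  ring

theorem lcross_triV_right (hy : mdot y y = 0) (hxy : mdot x y < 0) :
    lcross (triV x y) y = y := by
  have h := hxy.ne
  rw [triV_eq, lcross_smul_left, lcross_lcross_left, hy, zero_smul, zero_sub, smul_neg, neg_smul,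
    neg_neg, inv_smul_smul₀ h]

theorem lcross_triV_left (hx : mdot x x = 0) (hxy : mdot x y < 0) :
    lcross (triV x y) x = -x := by
  have h := hxy.ne
  rw [triV_eq, lcross_smul_left, lcross_lcross_left, hx, zero_smul, sub_zero, mdot_comm y x,
    neg_smul, inv_smul_smul₀ h]

theorem exists_of_mem_wingSet_nullPlus_triV {w : V3} (hx : mdot x x = 0) (hy : mdot y y = 0)
    (hxy : mdot x y < 0) (hfy : 0 < y 2) (hw : w ∈ wingSet (nullPlus (triV x y))) :
    ∃ s t : ℝ, 0 < s ∧ w = s • triV x y + t • y := by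
  have hfix := lcross_triV_right hy hxy
  obtain ⟨k, hk, h⟩ := exists_nullPlus_eq (mdot_triV_self hx hxy) hfy hfix
  rw [h] at hw
  obtain ⟨s, hs, hsw⟩ := exists_lcross_eq_of_mem_wingSet hk hw
  obtain ⟨t, ht⟩ := exists_smul_of_lcross_eq_zero (u := w - s • triV x y) hfy (by
    rw [lcross_sub_left, lcross_smul_left, hsw, hfix, sub_self])
  exact ⟨s, t, hs, by rw [← ht, add_sub_cancel]⟩

theorem exists_of_mem_wingSet_nullMinus_triV {w : V3} (hx : mdot x x = 0)
    (hxy : mdot x y < 0) (hfx : 0 < x 2) (hw : w ∈ wingSet (nullMinus (triV x y))) :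
    ∃ s t : ℝ, 0 < s ∧ w = -s • triV x y + t • x := by
  have hneg := lcross_triV_left hx hxy
  obtain ⟨k, hk, h⟩ := exists_nullMinus_eq (mdot_triV_self hx hxy) hfx hneg
  rw [h] at hw
  obtain ⟨s, hs, hsw⟩ := exists_lcross_eq_of_mem_wingSet hk hw
  obtain ⟨t, ht⟩ := exists_smul_of_lcross_eq_zero (u := w - -s • triV x y) hfx (by
    rw [lcross_sub_left, lcross_smul_left, hsw, hneg, smul_neg, neg_smul, neg_neg, sub_self])
  exact ⟨s, t, hs, by rw [← ht, add_sub_cancel]⟩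

theorem mdot_left_triV : mdot x (triV x y) = 0 := by
  rw [triV_eq, mdot_smul_right, mdot_lcross_self_left, mul_zero]

theorem mdot_right_triV : mdot y (triV x y) = 0 := by
  rw [triV_eq, mdot_smul_right, mdot_lcross_self_right, mul_zero]

/-- Two sides of an ideal triangle sharing a vertex are asymptotic. -/
theorem mdot_triV_triV {z : V3} (hy : mdot y y = 0) (hxy : mdot x y < 0) (hyz : mdot y z < 0) :
    mdot (triV x y) (triV y z) = -1 := by
  have h1 := hxy.ne
  have h2 := hyz.ne
  rw [triV_eq, triV_eq, mdot_smul_left, mdot_smul_right, mdot_lcross_lcross, hy]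
  field_simp
  ring

end Edge

section Triangle

variable {x y z : V3}

/-- Expansion of `w·w` in the coordinates dual to a triple of null vectors. -/
theorem sq_det_mul_mdot_self (hx : mdot x x = 0) (hy : mdot y y = 0) (hz : mdot z z = 0) (w : V3) :
    mdot x (lcross y z) ^ 2 * mdot w w =
      2 * (mdot w (lcross y z) * mdot w (lcross z x) * mdot x y +
        mdot w (lcross z x) * mdot w (lcross x y) * mdot y z +
        mdot w (lcross x y) * mdot w (lcross y z) * mdot z x) := by
  have key : mdot x (lcross y z) ^ 2 * mdot w w =
      mdot w (lcross y z) ^ 2 * mdot x x + mdot w (lcross z x) ^ 2 * mdot y y +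
        mdot w (lcross x y) ^ 2 * mdot z z +
      2 * (mdot w (lcross y z) * mdot w (lcross z x) * mdot x y +
        mdot w (lcross z x) * mdot w (lcross x y) * mdot y z +
        mdot w (lcross x y) * mdot w (lcross y z) * mdot z x) := by
    simp [mdot, lcross]; ring
  rw [key, hx, hy, hz]; ring

theorem sq_det_eq (hx : mdot x x = 0) (hy : mdot y y = 0) (hz : mdot z z = 0) :
    mdot x (lcross y z) ^ 2 = -2 * (mdot x y * mdot y z * mdot z x) := by
  have key : mdot x (lcross y z) ^ 2 = -(mdot x x * mdot y y * mdot z z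
      - mdot x x * mdot y z ^ 2 - mdot y y * mdot z x ^ 2 - mdot z z * mdot x y ^ 2)
      - 2 * (mdot x y * mdot y z * mdot z x) := by
    simp [mdot, lcross]; ring
  rw [key, hx, hy, hz]; ring

theorem det_neg_of_consistentlyOriented (hx : mdot x x = 0) (hy : mdot y y = 0) (hz : mdot z z = 0)
    (hfz : 0 < z 2) (hxy : mdot x y < 0) (hyz : mdot y z < 0) (hzx : mdot z x < 0)
    (hco : consistentlyOriented (triV x y) (triV y z)) : mdot x (lcross y z) < 0 := by
  obtain ⟨k, hk, h⟩ :=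
    exists_nullPlus_eq (mdot_triV_self hy hyz) hfz (lcross_triV_right hz hyz)
  have hle := hco.2.1
  rw [h, mdot_smul_right, mdot_comm, triV_eq, mdot_smul_right, mdot_lcross_rotate] at hle
  have hc : 0 < -(mdot x y)⁻¹ := neg_pos.2 (inv_lt_zero.2 hxy)
  have hle' : mdot x (lcross y z) ≤ 0 := by
    by_contra! hD
    exact hle.not_gt (mul_pos hk (mul_pos hc hD))
  refine hle'.lt_of_ne fun h0 => ?_
  have hsq := sq_det_eq hx hy hz
  rw [h0] at hsq
  have := mul_neg_of_pos_of_neg (mul_pos_of_neg_of_neg hxy hyz) hzx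
  linarith

/-- Position of a crooked plane over a side of an ideal triangle, read off in the three linear
functionals dual to the vertices. -/
theorem crookedPlane_triV_coords {a b : ℝ} {q : V3}
    (hx : mdot x x = 0) (hy : mdot y y = 0) (hz : mdot z z = 0) (hfx : 0 < x 2) (hfy : 0 < y 2)
    (hxy : mdot x y < 0) (hyz : mdot y z < 0) (hzx : mdot z x < 0)
    (hD : mdot x (lcross y z) < 0) (ha : 0 < a) (hb : 0 < b)
    (hq : q ∈ crookedPlane (triV x y) (a • x - b • y)) :
    ∃ α β : ℝ, 0 < α ∧ 0 < β ∧
      ((mdot q (triV x y) = 0 ∧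
          0 ≤ (-mdot q (triV y z) - α) * (-mdot q (triV z x) + β)) ∨
        (∃ s : ℝ, 0 < s ∧ -mdot q (triV y z) = α + s ∧ mdot q (triV x y) = s) ∨
        (∃ s : ℝ, 0 < s ∧ mdot q (triV z x) = β + s ∧ mdot q (triV x y) = -s)) := by
  have hcyz : 0 < -(mdot y z)⁻¹ := neg_pos.2 (inv_lt_zero.2 hyz)
  have hczx : 0 < -(mdot z x)⁻¹ := neg_pos.2 (inv_lt_zero.2 hzx)
  have hα : mdot x (triV y z) < 0 := by
    rw [triV_eq, mdot_smul_right]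
    exact mul_neg_of_pos_of_neg hcyz hD
  have hβ : mdot y (triV z x) < 0 := by
    rw [triV_eq, mdot_smul_right, ← mdot_lcross_rotate]
    exact mul_neg_of_pos_of_neg hczx hD
  have e1 : mdot (a • x - b • y) (triV x y) = 0 := by
    rw [mdot_sub_left, mdot_smul_left, mdot_smul_left, mdot_left_triV, mdot_right_triV]; ring
  have e2 : mdot (a • x - b • y) (triV y z) = a * mdot x (triV y z) := by
    rw [mdot_sub_left, mdot_smul_left, mdot_smul_left, mdot_left_triV]; ring
  have e3 : mdot (a • x - b • y) (triV z x) = -b * mdot y (triV z x) := by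
    rw [mdot_sub_left, mdot_smul_left, mdot_smul_left, mdot_right_triV]; ring
  have hunit := mdot_triV_self hx hxy
  have hxyz : mdot (triV x y) (triV y z) = -1 := mdot_triV_triV hy hxy hyz
  have hzxy : mdot (triV x y) (triV z x) = -1 := by
    rw [mdot_comm]; exact mdot_triV_triV hx hzx hxy
  refine ⟨-(a * mdot x (triV y z)), -(b * mdot y (triV z x)),
    by nlinarith, by nlinarith, ?_⟩
  rcases hq with (⟨hstem, hcausal⟩ | hplus) | hminus
  · left
    refine ⟨by simpa only [mdot_sub_left q, e1, sub_zero] using hstem, ?_⟩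
    have hdet : mdot (q - (a • x - b • y)) (lcross x y) = 0 := by
      rw [triV_eq, mdot_smul_right] at hstem
      exact (mul_eq_zero.1 hstem).resolve_left (neg_ne_zero.2 (inv_ne_zero hxy.ne))
    have hsq := sq_det_mul_mdot_self hx hy hz (q - (a • x - b • y))
    rw [hdet] at hsq
    have hnonpos := mul_nonpos_of_nonneg_of_nonpos (sq_nonneg (mdot x (lcross y z))) hcausal
    have hprod : 0 ≤ mdot (q - (a • x - b • y)) (lcross y z) *
        mdot (q - (a • x - b • y)) (lcross z x) := by
      by_contra! hlt
      have := mul_pos_of_neg_of_neg hlt hxy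
      linarith
    have hdual : 0 ≤ mdot (q - (a • x - b • y)) (triV y z) *
        mdot (q - (a • x - b • y)) (triV z x) := by
      rw [triV_eq y z, triV_eq z x, mdot_smul_right, mdot_smul_right, mul_mul_mul_comm]
      exact mul_nonneg (mul_pos hcyz hczx).le hprod
    rw [mdot_sub_left q, mdot_sub_left q, e2, e3] at hdual
    linarith
  · right; left
    obtain ⟨s, t, hs, hw⟩ := exists_of_mem_wingSet_nullPlus_triV hx hy hxy hfy hplus
    rw [sub_eq_iff_eq_add] at hw
    refine ⟨s, hs, ?_, ?_⟩ <;>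
      rw [hw, mdot_add_left, mdot_add_left, mdot_smul_left, mdot_smul_left]
    · rw [e2, hxyz, mdot_left_triV]; ring
    · rw [e1, hunit, mdot_right_triV]; ring
  · right; right
    obtain ⟨s, t, hs, hw⟩ := exists_of_mem_wingSet_nullMinus_triV hx hxy hfx hminus
    rw [sub_eq_iff_eq_add] at hw
    refine ⟨s, hs, ?_, ?_⟩ <;>
      rw [hw, mdot_add_left, mdot_add_left, mdot_smul_left, mdot_smul_left]
    · rw [e3, hzxy, mdot_right_triV]; ring
    · rw [e1, hunit, mdot_left_triV]; ring

theorem crookedPlane_triV_inter_eq_empty {a b c d : ℝ}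
    (hx : mdot x x = 0) (hy : mdot y y = 0) (hz : mdot z z = 0)
    (hfx : 0 < x 2) (hfy : 0 < y 2) (hfz : 0 < z 2)
    (hxy : mdot x y < 0) (hyz : mdot y z < 0) (hzx : mdot z x < 0)
    (hD : mdot x (lcross y z) < 0) (ha : 0 < a) (hb : 0 < b) (hc : 0 < c) (hd : 0 < d) :
    crookedPlane (triV x y) (a • x - b • y) ∩ crookedPlane (triV y z) (c • y - d • z) = ∅ := by
  rw [Set.eq_empty_iff_forall_notMem]
  rintro q ⟨h1, h2⟩
  obtain ⟨α, β, hα, hβ, h1⟩ :=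
    crookedPlane_triV_coords hx hy hz hfx hfy hxy hyz hzx hD ha hb h1
  obtain ⟨γ, δ, hγ, hδ, h2⟩ :=
    crookedPlane_triV_coords hy hz hx hfy hfz hyz hzx hxy
      (by rwa [← mdot_lcross_rotate]) hc hd h2
  rcases h1 with ⟨h3, h12⟩ | ⟨s, hs, h1, h3⟩ | ⟨s, hs, h2', h3⟩
  · have hle : -mdot q (triV z x) + β ≤ 0 ∨ 0 ≤ -mdot q (triV y z) - α := by
      by_contra! hcon
      nlinarith
    rcases h2 with ⟨k1, k23⟩ | ⟨r, hr, k2, k1⟩ | ⟨r, hr, k3, k1⟩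
    · rw [h3, neg_zero, zero_add] at k23
      have := nonneg_of_mul_nonneg_left k23 hδ
      rcases hle with hle | hle <;> linarith
    · rcases hle with hle | hle <;> linarith
    · linarith
  · rcases h2 with ⟨k1, -⟩ | ⟨r, hr, k2, k1⟩ | ⟨r, hr, k3, k1⟩ <;> linarith
  · rcases h2 with ⟨k1, k23⟩ | ⟨r, hr, k2, k1⟩ | ⟨r, hr, k3, k1⟩
    · have hpos : 0 < -mdot q (triV x y) + δ := by linarith
      have := nonneg_of_mul_nonneg_left k23 hpos
      linarith
    · linarith
    · linarith

end Triangle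

/-- For pairwise linearly independent future-pointing null vectors
`x₁, x₂, x₃` (indices mod 3), the vectors `vᵢ = −(xᵢ⊠xᵢ₊₁)/(xᵢ·xᵢ₊₁)` are unit
spacelike, and if they are pairwise consistently oriented then for any
`aᵢ, bᵢ > 0` and `pᵢ = aᵢxᵢ − bᵢxᵢ₊₁` the crooked planes `C(vᵢ,pᵢ)` are
pairwise disjoint. -/
theorem three_crooked_planes_disjoint
    (x1 x2 x3 : V3) (a1 b1 a2 b2 a3 b3 : ℝ)
    (hn1 : mdot x1 x1 = 0) (hn2 : mdot x2 x2 = 0) (hn3 : mdot x3 x3 = 0)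
    (hf1 : 0 < x1 2) (hf2 : 0 < x2 2) (hf3 : 0 < x3 2)
    (hli12 : LinearIndependent ℝ ![x1, x2])
    (hli23 : LinearIndependent ℝ ![x2, x3])
    (hli31 : LinearIndependent ℝ ![x3, x1])
    (hco12 : consistentlyOriented (triV x1 x2) (triV x2 x3))
    (hco23 : consistentlyOriented (triV x2 x3) (triV x3 x1))
    (hco31 : consistentlyOriented (triV x3 x1) (triV x1 x2))
    (ha1 : 0 < a1) (hb1 : 0 < b1) (ha2 : 0 < a2) (hb2 : 0 < b2)
    (ha3 : 0 < a3) (hb3 : 0 < b3) :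
    (mdot (triV x1 x2) (triV x1 x2) = 1 ∧
     mdot (triV x2 x3) (triV x2 x3) = 1 ∧
     mdot (triV x3 x1) (triV x3 x1) = 1) ∧
    crookedPlane (triV x1 x2) (a1 • x1 - b1 • x2) ∩
      crookedPlane (triV x2 x3) (a2 • x2 - b2 • x3) = ∅ ∧
    crookedPlane (triV x2 x3) (a2 • x2 - b2 • x3) ∩
      crookedPlane (triV x3 x1) (a3 • x3 - b3 • x1) = ∅ ∧
    crookedPlane (triV x3 x1) (a3 • x3 - b3 • x1) ∩
      crookedPlane (triV x1 x2) (a1 • x1 - b1 • x2) = ∅ := by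
  have h12 := mdot_neg_of_null hn1 hn2 hf1 hf2 hli12
  have h23 := mdot_neg_of_null hn2 hn3 hf2 hf3 hli23
  have h31 := mdot_neg_of_null hn3 hn1 hf3 hf1 hli31
  have hD1 := det_neg_of_consistentlyOriented hn1 hn2 hn3 hf3 h12 h23 h31 hco12
  have hD2 := det_neg_of_consistentlyOriented hn2 hn3 hn1 hf1 h23 h31 h12 hco23
  have hD3 := det_neg_of_consistentlyOriented hn3 hn1 hn2 hf2 h31 h12 h23 hco31
  exact ⟨⟨mdot_triV_self hn1 h12, mdot_triV_self hn2 h23, mdot_triV_self hn3 h31⟩,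
    crookedPlane_triV_inter_eq_empty hn1 hn2 hn3 hf1 hf2 hf3 h12 h23 h31 hD1 ha1 hb1 ha2 hb2,
    crookedPlane_triV_inter_eq_empty hn2 hn3 hn1 hf2 hf3 hf1 h23 h31 h12 hD2 ha2 hb2 ha3 hb3,
    crookedPlane_triV_inter_eq_empty hn3 hn1 hn2 hf3 hf1 hf2 h31 h12 h23 hD3 ha3 hb3 ha1 hb1⟩
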